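/- Let F be a field, X a finite partial order, G an additive abelian group, and A = IncidenceAlgebra F X equipped with a G-grading ℬ (GradedAlgebra ℬ). Let e, f ∈ ℬ 0 be nonzero idempotents with e*f = 0 and f*e = 0, each minimal in the sense that every nonzero idempotent e' ∈ ℬ 0 with e*e' = e' (resp. f*e' = e') satisfies e'*e = e (resp. e'*f = f). Then the F-dimension of the subspace e·A·f = {e*a*f | a ∈ A} is divisible both by the F-dimension of e·A·e and by the F-dimension of f·A·f. -/

import Mathlib

/-- The linear map `x ↦ e * x * f` on an algebra. -/
noncomputable def cornerMap (F : Type*) {A : Type*} [Field F] [Ring A] [Algebra F A]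
    (e f : A) : A →ₗ[F] A :=
  (LinearMap.mulRight F f).comp (LinearMap.mulLeft F e)

open Polynomial in
/-- Fitting's lemma for a single element of a finite-dimensional algebra. -/
lemma exists_pow_succ_mul_aeval_eq_pow {F A : Type*} [Field F] [Ring A] [Algebra F A]
    [FiniteDimensional F A] (a : A) :
    ∃ (n : ℕ) (p : F[X]), a ^ (n + 1) * aeval a p = a ^ n := by
  obtain ⟨q, hq, hdvd⟩ := exists_eq_pow_rootMultiplicity_mul_and_not_dvd (minpoly F a)
    (minpoly.ne_zero (Algebra.IsIntegral.isIntegral a)) 0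
  set n := rootMultiplicity 0 (minpoly F a)
  rw [C_0, sub_zero] at hq hdvd
  have hq0 : q.coeff 0 ≠ 0 := fun h => hdvd (X_dvd_iff.mpr h)
  refine ⟨n, -C (q.coeff 0)⁻¹ * q.divX, ?_⟩
  have h0 : aeval a (X ^ n * q) = 0 := by rw [← hq, minpoly.aeval]
  have key : (X : F[X]) ^ (n + 1) * (-C (q.coeff 0)⁻¹ * q.divX)
      = X ^ n - C (q.coeff 0)⁻¹ * (X ^ n * q) := by
    have h1 : C (q.coeff 0)⁻¹ * C (q.coeff 0) = (1 : F[X]) := by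
      rw [← C_mul, inv_mul_cancel₀ hq0, C_1]
    have h2 := divX_mul_X_add q
    calc _ = X ^ n - C (q.coeff 0)⁻¹ * (X ^ n * (q.divX * X + C (q.coeff 0))) := by
          linear_combination (X : F[X]) ^ n * h1
      _ = _ := by rw [h2]
  have := congrArg (aeval a) key
  simpa [h0] using this

namespace GradedAlgebra

open DirectSum Polynomial

variable {F A G : Type*} [Field F] [Ring A] [Algebra F A] [AddCommGroup G] [DecidableEq G]

lemma exists_pos_nsmul_eq_zero [FiniteDimensional F A] (𝒜 : G → Submodule F A) [GradedAlgebra 𝒜]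
    {g : G} {b : A} (hb : b ∈ 𝒜 g) (hpow : ∀ n : ℕ, b ^ n ≠ 0) : ∃ n : ℕ, 0 < n ∧ n • g = 0 := by
  have hfin : {i | 𝒜 i ≠ ⊥}.Finite := WellFoundedGT.finite_ne_bot_of_iSupIndep
    (Decomposition.isInternal 𝒜).submodule_iSupIndep
  have hmem (n : ℕ) : n • g ∈ {i | 𝒜 i ≠ ⊥} := fun h =>
    hpow n <| (Submodule.mem_bot F).mp <| h ▸ SetLike.pow_mem_graded n hb
  obtain ⟨m, -, n, -, hne, heq⟩ := Set.infinite_univ.exists_ne_map_eq_of_mapsTo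
    (f := fun n : ℕ => n • g) (fun n _ => hmem n) hfin
  wlog hlt : m < n generalizing m n
  · exact this n m hne.symm heq.symm (by omega)
  refine ⟨n - m, by omega, ?_⟩
  have : (n - m + m) • g = m • g := by rw [Nat.sub_add_cancel hlt.le]; exact heq.symm
  simpa [add_nsmul] using this

/-- A non-nilpotent homogeneous element of the corner of a minimal idempotent of degree zero is
invertible in the corner. -/
lemma exists_corner_inverse [FiniteDimensional F A] (𝒜 : G → Submodule F A) [GradedAlgebra 𝒜]
    {e : A} (he : e * e = e)
    (hmin : ∀ e' : A, e' ∈ 𝒜 0 → e' * e' = e' → e' ≠ 0 → e * e' = e' → e' * e = e)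
    {g : G} {b : A} (hb : b ∈ 𝒜 g) (heb : e * b = b) (hbe : b * e = b)
    (hpow : ∀ n : ℕ, b ^ n ≠ 0) :
    ∃ c, e * c = c ∧ c * e = c ∧ c * b = e ∧ b * c = e := by
  obtain ⟨m, hm, hmg⟩ := exists_pos_nsmul_eq_zero 𝒜 hb hpow
  obtain ⟨n, p, hp⟩ := exists_pow_succ_mul_aeval_eq_pow (F := F) (b ^ m)
  have hbm : b ^ m ∈ 𝒜 0 := hmg ▸ SetLike.pow_mem_graded m hb
  set y := aeval (b ^ m) p with hy
  have hy0 : y ∈ 𝒜 0 := by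
    have : Algebra.adjoin F {b ^ m} ≤ SetLike.GradeZero.subalgebra 𝒜 :=
      Algebra.adjoin_le (Set.singleton_subset_iff.mpr hbm)
    exact this (aeval_mem_adjoin_singleton F (b ^ m))
  have hcomm : Commute b y := by
    have h : y = aeval b (p.comp (X ^ m)) := by rw [aeval_comp, hy]; simp
    rw [h]
    simpa using (Commute.all X (p.comp (X ^ m))).map (aeval b)
  have hstep (k : ℕ) : (b ^ m) ^ (n + 1 + k) * y ^ k = (b ^ m) ^ (n + 1) := by
    induction k with
    | zero => simp
    | succ k ih =>
      rw [pow_succ' y, ← mul_assoc, show n + 1 + (k + 1) = (1 + k) + (n + 1) by ring,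
        pow_add _ (1 + k), mul_assoc _ _ y, hp, ← pow_add,
        show 1 + k + n = n + 1 + k by ring, ih]
  set E := (b ^ m) ^ (n + 1) * y ^ (n + 1) with hE
  have hcomm' : Commute ((b ^ m) ^ (n + 1)) (y ^ (n + 1)) :=
    ((hcomm.pow_left m).pow_left (n + 1)).pow_right (n + 1)
  have haE : (b ^ m) ^ (n + 1) * E = (b ^ m) ^ (n + 1) := by
    rw [hE, ← mul_assoc, ← pow_add, hstep]
  have hEE : E * E = E := by
    nth_rw 1 [hE]
    rw [hcomm'.eq, mul_assoc, haE, hE, hcomm'.eq]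
  have hE0 : E ≠ 0 := fun h => by
    rw [h, mul_zero, ← pow_mul] at haE
    exact hpow _ haE.symm
  have hEmem : E ∈ 𝒜 0 := (SetLike.GradeZero.subalgebra 𝒜).mul_mem
    ((SetLike.GradeZero.subalgebra 𝒜).pow_mem hbm _)
    ((SetLike.GradeZero.subalgebra 𝒜).pow_mem hy0 _)
  obtain ⟨k, hk⟩ : ∃ k, m * (n + 1) = k + 1 :=
    ⟨m * (n + 1) - 1, (Nat.sub_add_cancel (Nat.mul_pos hm n.succ_pos)).symm⟩
  have hEb : E = b * (b ^ k * y ^ (n + 1)) := by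
    rw [hE, ← pow_mul, hk, pow_succ', mul_assoc]
  have hEb' : E = b ^ k * y ^ (n + 1) * b := by
    rw [hEb, ((Commute.pow_right (Commute.refl b) k).mul_right (hcomm.pow_right _)).eq]
  have heE : e * E = E := by rw [hEb, ← mul_assoc, heb]
  have hEe : E * e = E := by rw [hEb', mul_assoc, hbe]
  have hEq : E = e := hEe.symm.trans (hmin E hEmem hEE hE0 heE)
  rw [hEq] at hEb hEb'
  have h1 : b * (b ^ k * y ^ (n + 1) * e) = e := by rw [← mul_assoc, ← hEb, he]
  refine ⟨e * (b ^ k * y ^ (n + 1) * e), ?_, ?_, ?_, ?_⟩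
  · rw [← mul_assoc, he]
  · rw [mul_assoc, mul_assoc, he]
  · rw [mul_assoc, mul_assoc, heb, ← hEb', he]
  · rw [← mul_assoc, hbe, h1]

/-- A graded space on which a graded space of operators acts freely has dimension divisible by that
of the operators. Both spaces live in the same ambient graded module, and every nonzero
homogeneous operator is assumed to have an inverse. -/
lemma finrank_dvd_finrank_of_graded_division_action [FiniteDimensional F A]
    (𝒜 : G → Submodule F A) [Decomposition 𝒜] (m : A →ₗ[F] A →ₗ[F] A) (K V : Submodule F A)
    (hK : ∀ b ∈ K, ∀ g, (decompose 𝒜 b g : A) ∈ K)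
    (hV : ∀ v ∈ V, ∀ g, (decompose 𝒜 v g : A) ∈ V)
    (hm : ∀ b v : A, ∀ g h, v ∈ 𝒜 g →
      (decompose 𝒜 (m b v) (h + g) : A) = m (decompose 𝒜 b h) v)
    (hKV : ∀ b ∈ K, ∀ v ∈ V, m b v ∈ V)
    (hassoc : ∀ b ∈ K, ∀ b' ∈ K, ∃ c ∈ K, ∀ v ∈ V, m b (m b' v) = m c v)
    (hone : ∃ u ∈ K, ∀ v ∈ V, m u v = v)
    (hinv : ∀ g, ∀ b ∈ K, b ∈ 𝒜 g → b ≠ 0 → ∃ c ∈ K, ∀ v ∈ V, m c (m b v) = v) :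
    Module.finrank F K ∣ Module.finrank F V := by
  classical
  let P : Set (Submodule F A) := {W | W ≤ V ∧ (∀ w ∈ W, ∀ g, (decompose 𝒜 w g : A) ∈ W) ∧
    (∀ b ∈ K, ∀ w ∈ W, m b w ∈ W) ∧ Module.finrank F K ∣ Module.finrank F W}
  have hP : P.Nonempty := ⟨⊥, bot_le, by simp, by simp, by simp⟩
  obtain ⟨W, ⟨hWV, hWgr, hWK, hWdvd⟩, hmax⟩ :=
    WellFounded.has_min (wellFounded_gt (α := Submodule F A)) P hP
  suffices hle : V ≤ W by rwa [le_antisymm hle hWV]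
  by_contra hle
  obtain ⟨v, hvV, hvW⟩ := Set.not_subset.mp hle
  obtain ⟨g, hg⟩ : ∃ g, (decompose 𝒜 v g : A) ∉ W := by
    by_contra! h
    refine hvW ?_
    rw [← sum_support_decompose 𝒜 v]
    exact W.sum_mem fun g _ => h g
  set w : A := (decompose 𝒜 v g : A)
  have hwV : w ∈ V := hV v hvV g
  have hwg : w ∈ 𝒜 g := (decompose 𝒜 v g).2
  have hfree : ∀ b ∈ K, m b w ∈ W → b = 0 := by
    intro b hb hbw
    have hcomp (h : G) : (decompose 𝒜 b h : A) = 0 := by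
      by_contra hne
      obtain ⟨c, hc, hcw⟩ := hinv h _ (hK b hb h) (decompose 𝒜 b h).2 hne
      refine hg ?_
      rw [← hcw w hwV, ← hm b w g h hwg]
      exact hWK c hc _ (hWgr _ hbw _)
    rw [← sum_support_decompose 𝒜 b]
    exact Finset.sum_eq_zero fun h _ => hcomp h
  let φ : K →ₗ[F] A := (m.flip w).comp K.subtype
  have hφ (b : K) : φ b = m b w := rfl
  have hinj : Function.Injective φ := by
    rw [← LinearMap.ker_eq_bot, LinearMap.ker_eq_bot']
    intro b hb
    exact Subtype.ext (hfree b b.2 (by rw [← hφ, hb]; exact W.zero_mem))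
  have hdisj : W ⊓ LinearMap.range φ = ⊥ := by
    rw [eq_bot_iff]
    rintro _ ⟨hxW, b, rfl⟩
    have : (b : A) = 0 := hfree b b.2 hxW
    simp [hφ, this]
  have hrank : Module.finrank F ↥(W ⊔ LinearMap.range φ)
      = Module.finrank F W + Module.finrank F K := by
    have := Submodule.finrank_sup_add_finrank_inf_eq W (LinearMap.range φ)
    rwa [hdisj, finrank_bot, add_zero, LinearMap.finrank_range_of_inj hinj] at this
  refine hmax (W ⊔ LinearMap.range φ) ⟨?_, ?_, ?_, ?_⟩ ?_
  · refine sup_le hWV ?_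
    rintro _ ⟨b, rfl⟩
    exact hKV b b.2 w hwV
  · intro x hx h
    obtain ⟨x₁, hx₁, _, ⟨b, rfl⟩, rfl⟩ := Submodule.mem_sup.mp hx
    rw [decompose_add, DirectSum.add_apply, Submodule.coe_add]
    refine Submodule.add_mem_sup (hWgr _ hx₁ h) ⟨⟨_, hK b b.2 (h - g)⟩, ?_⟩
    have := hm b w g (h - g) hwg
    rw [sub_add_cancel] at this
    exact this.symm
  · intro b hb x hx
    obtain ⟨x₁, hx₁, _, ⟨b', rfl⟩, rfl⟩ := Submodule.mem_sup.mp hx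
    obtain ⟨c, hc, hcv⟩ := hassoc b hb b' b'.2
    rw [map_add]
    exact Submodule.add_mem_sup (hWK b hb _ hx₁) ⟨⟨c, hc⟩, (hcv w hwV).symm⟩
  · rw [hrank]
    exact dvd_add hWdvd dvd_rfl
  · refine lt_of_le_of_ne le_sup_left fun heq => hg ?_
    obtain ⟨u, hu, huv⟩ := hone
    have : w ∈ W ⊔ LinearMap.range φ := Submodule.mem_sup_right ⟨⟨u, hu⟩, huv w hwV⟩
    rwa [← heq] at this

end GradedAlgebra

lemma mem_range_cornerMap {F A : Type*} [Field F] [Ring A] [Algebra F A] {e f : A}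
    (he : e * e = e) (hf : f * f = f) {v : A} :
    v ∈ LinearMap.range (cornerMap F e f) ↔ e * v = v ∧ v * f = v := by
  constructor
  · rintro ⟨a, rfl⟩
    simp only [cornerMap, LinearMap.comp_apply, LinearMap.mulLeft_apply, LinearMap.mulRight_apply]
    constructor
    · rw [← mul_assoc, ← mul_assoc, he]
    · rw [mul_assoc, hf]
  · rintro ⟨h₁, h₂⟩
    exact ⟨v, by simp [cornerMap, h₁, h₂]⟩

lemma decompose_mem_range_cornerMap {F A G : Type*} [Field F] [Ring A] [Algebra F A]
    [AddCommGroup G] [DecidableEq G] (𝒜 : G → Submodule F A) [GradedAlgebra 𝒜] {e f : A}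
    (he_mem : e ∈ 𝒜 0) (hf_mem : f ∈ 𝒜 0) (he : e * e = e) (hf : f * f = f) {v : A}
    (hv : v ∈ LinearMap.range (cornerMap F e f)) (g : G) :
    (DirectSum.decompose 𝒜 v g : A) ∈ LinearMap.range (cornerMap F e f) := by
  rw [mem_range_cornerMap he hf] at hv ⊢
  rw [← DirectSum.coe_decompose_mul_of_left_mem_zero 𝒜 he_mem,
    ← DirectSum.coe_decompose_mul_of_right_mem_zero 𝒜 hf_mem, hv.1, hv.2]
  exact ⟨rfl, rfl⟩

namespace IncidenceAlgebra

variable {F X : Type*} [Field F] [PartialOrder X]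

instance finiteDimensional [Finite X] : FiniteDimensional F (IncidenceAlgebra F X) :=
  Module.Finite.of_injective
    ({ toFun := fun a => ⇑a, map_add' := fun _ _ => rfl, map_smul' := fun _ _ => rfl } :
      IncidenceAlgebra F X →ₗ[F] X → X → F) DFunLike.coe_injective

lemma sum_apply {ι : Type*} (s : Finset ι) (a : ι → IncidenceAlgebra F X) (x y : X) :
    (∑ i ∈ s, a i) x y = ∑ i ∈ s, a i x y := by
  classical
  induction s using Finset.induction_on with
  | empty => simp
  | insert i s hi ih => rw [Finset.sum_insert hi, Finset.sum_insert hi, add_apply, ih]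

/-- The diagonal idempotent at a point. -/
def single (F : Type*) [Field F] [DecidableEq X] (x : X) : IncidenceAlgebra F X :=
  ⟨fun a b => if a = x ∧ b = x then 1 else 0, fun _ _ h => if_neg fun ⟨h₁, h₂⟩ =>
    h (h₁.trans h₂.symm).le⟩

lemma single_apply [DecidableEq X] (x a b : X) : single F x a b = if a = x ∧ b = x then 1 else 0 := rfl

variable [LocallyFiniteOrder X]

lemma mul_apply_self (a b : IncidenceAlgebra F X) (x : X) : (a * b) x x = a x x * b x x := by
  simp

lemma exists_apply_ne_zero_of_mul_eq_self {j e : IncidenceAlgebra F X} (hj : j * e = j) {p q : X}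
    (h : j p q ≠ 0) : ∃ u, j p u ≠ 0 ∧ e u u ≠ 0 := by
  classical
  obtain ⟨u, hu, hmin⟩ := (Finset.Icc p q |>.filter (j p · ≠ 0)).exists_minimal
    ⟨q, by simp [h, le_of_ne_zero h]⟩
  simp only [Finset.mem_filter, Finset.mem_Icc] at hu hmin
  refine ⟨u, hu.2, fun he => hu.2 ?_⟩
  rw [← hj, mul_apply]
  refine Finset.sum_eq_zero fun w hw => ?_
  rw [Finset.mem_Icc] at hw
  by_cases hjw : j p w = 0
  · rw [hjw, zero_mul]
  · rw [le_antisymm hw.2 (hmin ⟨⟨hw.1, hw.2.trans hu.1.2⟩, hjw⟩ hw.2), he, mul_zero]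

variable [DecidableEq X]

lemma pow_apply_self (a : IncidenceAlgebra F X) (x : X) (n : ℕ) : (a ^ n) x x = a x x ^ n := by
  induction n with
  | zero => simp
  | succ n ih => rw [pow_succ, mul_apply_self, ih, pow_succ]

lemma single_mul_apply (x : X) (a : IncidenceAlgebra F X) (p q : X) :
    (single F x * a) p q = if p = x then a x q else 0 := by
  rw [mul_apply]
  split_ifs with h
  · subst h
    by_cases hpq : p ≤ q
    · rw [Finset.sum_eq_single p]
      · simp [single_apply]
      · intro b _ hb
        simp [single_apply, hb]
      · simp [hpq]
    · rw [apply_eq_zero_of_not_le hpq, Finset.Icc_eq_empty hpq, Finset.sum_empty]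
  · exact Finset.sum_eq_zero fun w _ => by simp [single_apply, h]

lemma mul_single_mul_apply (a : IncidenceAlgebra F X) (x : X) (b : IncidenceAlgebra F X) (p q : X) :
    (a * single F x * b) p q = a p x * b x q := by
  rw [mul_assoc, mul_apply]
  simp only [single_mul_apply, mul_ite, mul_zero]
  rw [Finset.sum_ite_eq', ite_eq_left_iff]
  intro h
  rw [Finset.mem_Icc, not_and_or] at h
  rcases h with h | h <;> simp [apply_eq_zero_of_not_le h]

/-- If the corner of an idempotent is commutative, then it has no nonzero element with zero
diagonal. -/
lemma eq_zero_of_apply_self_eq_zero_of_commute {e j : IncidenceAlgebra F X} (he : e * e = e)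
    (hcomm : ∀ a, e * a = a → a * e = a → Commute a j) (hej : e * j = j) (hje : j * e = j)
    (hj : ∀ x, j x x = 0) : j = 0 := by
  ext p q -
  by_contra hpq
  obtain ⟨u, hpu, huu⟩ := exists_apply_ne_zero_of_mul_eq_self hje hpq
  have h := hcomm (e * single F u * e) (by rw [← mul_assoc, ← mul_assoc, he])
    (by rw [mul_assoc, he])
  have h' : e * single F u * j = j * single F u * e := by
    calc e * single F u * j = e * single F u * e * j := by rw [mul_assoc _ e j, hej]
      _ = j * (e * single F u * e) := h.eq
      _ = j * single F u * e := by rw [← mul_assoc, ← mul_assoc, hje]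
  have := congrArg (fun a : IncidenceAlgebra F X => a p u) h'
  simp only [mul_single_mul_apply, hj, mul_zero] at this
  exact mul_ne_zero hpu huu this.symm

section Graded

variable [Finite X] {G : Type*} [AddCommGroup G] [DecidableEq G]
  (ℬ : G → Submodule F (IncidenceAlgebra F X)) [GradedAlgebra ℬ]

/-- The corner of a minimal idempotent of degree zero is commutative. -/
lemma commute_of_minimal_idempotent {e : IncidenceAlgebra F X} (he_mem : e ∈ ℬ 0)
    (he : e * e = e) (hne : e ≠ 0)
    (hmin : ∀ e' : IncidenceAlgebra F X, e' ∈ ℬ 0 → e' * e' = e' → e' ≠ 0 → e * e' = e' →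
      e' * e = e)
    {a b : IncidenceAlgebra F X} (hea : e * a = a) (hae : a * e = a) (heb : e * b = b)
    (hbe : b * e = b) : Commute a b := by
  classical
  have hmem {v : IncidenceAlgebra F X} := mem_range_cornerMap (F := F) he he (v := v)
  have hdec {v : IncidenceAlgebra F X} (h₁ : e * v = v) (h₂ : v * e = v) (g : G) :=
    hmem.mp (decompose_mem_range_cornerMap ℬ he_mem he_mem he he (hmem.mpr ⟨h₁, h₂⟩) g)
  obtain ⟨x, hx, hxmax⟩ : ∃ x, Maximal (fun x => e x x ≠ 0) x := by
    refine Set.Finite.exists_maximal (Set.toFinite {x | e x x ≠ 0}) ?_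
    by_contra hempty
    refine hne (ext fun p q _ => ?_)
    by_contra hpq
    obtain ⟨u, -, hu⟩ := exists_apply_ne_zero_of_mul_eq_self he hpq
    exact hempty ⟨u, hu⟩
  set d := e * single F x * e with hd
  have hdx : d x x ≠ 0 := by
    rw [hd, mul_single_mul_apply]
    exact mul_ne_zero hx hx
  have hd₁ : e * d = d := by rw [hd, ← mul_assoc, ← mul_assoc, he]
  have hd₂ : d * e = d := by rw [hd, mul_assoc, he]
  have hdj {j : IncidenceAlgebra F X} (hej : e * j = j) (hje : j * e = j) (hj : j x x = 0) :
      d * j = 0 := by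
    rw [hd, mul_assoc, hej]
    ext p q -
    rw [mul_single_mul_apply]
    suffices j x q = 0 by simp [this]
    by_contra hxq
    obtain ⟨u, hxu, huu⟩ := exists_apply_ne_zero_of_mul_eq_self hje hxq
    have : u = x := le_antisymm (hxmax huu (le_of_ne_zero hxu)) (le_of_ne_zero hxu)
    exact hxu (this ▸ hj)
  obtain ⟨k, hk⟩ : ∃ k, (DirectSum.decompose ℬ d k : IncidenceAlgebra F X) x x ≠ 0 := by
    by_contra! h
    rw [← DirectSum.sum_support_decompose ℬ d, sum_apply] at hdx
    exact hdx (Finset.sum_eq_zero fun k _ => h k)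
  obtain ⟨c, -, -, hc, -⟩ := GradedAlgebra.exists_corner_inverse ℬ he hmin
    (DirectSum.decompose ℬ d k).2 (hdec hd₁ hd₂ k).1 (hdec hd₁ hd₂ k).2 fun n h => by
      have := congrArg (fun a : IncidenceAlgebra F X => a x x) h
      simp only [pow_apply_self] at this
      exact pow_ne_zero n hk this
  have hhom {g h : G} {a b : IncidenceAlgebra F X} (hag : a ∈ ℬ g) (hbh : b ∈ ℬ h)
      (hea : e * a = a) (hae : a * e = a) (heb : e * b = b) (hbe : b * e = b) : Commute a b := by
    set j := a * b - b * a with hj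
    have hej : e * j = j := by rw [hj, mul_sub, ← mul_assoc, ← mul_assoc, hea, heb]
    have hje : j * e = j := by rw [hj, sub_mul, mul_assoc, mul_assoc, hae, hbe]
    have hjx : j x x = 0 := by
      rw [hj, sub_apply, mul_apply_self, mul_apply_self, mul_comm, sub_self]
    have hjgr : j ∈ ℬ (g + h) := Submodule.sub_mem _ (SetLike.mul_mem_graded hag hbh)
      (add_comm h g ▸ SetLike.mul_mem_graded hbh hag)
    have hdkj : (DirectSum.decompose ℬ d k : IncidenceAlgebra F X) * j = 0 := by
      rw [← DirectSum.coe_decompose_mul_add_of_right_mem ℬ hjgr, hdj hej hje hjx]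
      simp
    rw [commute_iff_eq, ← sub_eq_zero, ← hj, ← hej, ← hc, mul_assoc, hdkj, mul_zero]
  rw [← DirectSum.sum_support_decompose ℬ a, ← DirectSum.sum_support_decompose ℬ b]
  refine Commute.sum_left _ _ _ fun g _ => Commute.sum_right _ _ _ fun h _ => ?_
  exact hhom (DirectSum.decompose ℬ a g).2 (DirectSum.decompose ℬ b h).2
    (hdec hea hae g).1 (hdec hea hae g).2 (hdec heb hbe h).1 (hdec heb hbe h).2

/-- The corner of a minimal idempotent of degree zero is a graded division algebra. -/
lemma exists_corner_inverse_of_ne_zero {e : IncidenceAlgebra F X} (he_mem : e ∈ ℬ 0)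
    (he : e * e = e) (hne : e ≠ 0)
    (hmin : ∀ e' : IncidenceAlgebra F X, e' ∈ ℬ 0 → e' * e' = e' → e' ≠ 0 → e * e' = e' →
      e' * e = e)
    {g : G} {b : IncidenceAlgebra F X} (hb : b ∈ ℬ g) (heb : e * b = b) (hbe : b * e = b)
    (hb0 : b ≠ 0) : ∃ c, e * c = c ∧ c * e = c ∧ c * b = e ∧ b * c = e := by
  refine GradedAlgebra.exists_corner_inverse ℬ he hmin hb heb hbe fun n hn => hb0 ?_
  refine eq_zero_of_apply_self_eq_zero_of_commute he (fun a hea hae =>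
    commute_of_minimal_idempotent ℬ he_mem he hne hmin hea hae heb hbe) heb hbe fun x => ?_
  have := congrArg (fun a : IncidenceAlgebra F X => a x x) hn
  simp only [pow_apply_self] at this
  exact eq_zero_of_pow_eq_zero this

end Graded

end IncidenceAlgebra

/-- For two orthogonal minimal homogeneous idempotents `e, f` of a graded incidence
algebra, the dimension of `e·A·f` is divisible by the dimensions of both corners
`e·A·e` and `f·A·f`. -/
theorem dim_corner_dvd_of_minimal_idempotents
    {F X G : Type*} [Field F] [PartialOrder X] [Fintype X] [DecidableEq X]
    [LocallyFiniteOrder X] [AddCommGroup G] [DecidableEq G]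
    (ℬ : G → Submodule F (IncidenceAlgebra F X)) [GradedAlgebra ℬ]
    (e f : IncidenceAlgebra F X)
    (he_mem : e ∈ ℬ 0) (hf_mem : f ∈ ℬ 0)
    (he_idem : e * e = e) (hf_idem : f * f = f)
    (he_ne : e ≠ 0) (hf_ne : f ≠ 0)
    (hef : e * f = 0) (hfe : f * e = 0)
    (he_min : ∀ e' : IncidenceAlgebra F X, e' ∈ ℬ 0 → e' * e' = e' → e' ≠ 0 →
      e * e' = e' → e' * e = e)
    (hf_min : ∀ e' : IncidenceAlgebra F X, e' ∈ ℬ 0 → e' * e' = e' → e' ≠ 0 →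
      f * e' = e' → e' * f = f) :
    Module.finrank F ↥(LinearMap.range (cornerMap F e e)) ∣
      Module.finrank F ↥(LinearMap.range (cornerMap F e f)) ∧
    Module.finrank F ↥(LinearMap.range (cornerMap F f f)) ∣
      Module.finrank F ↥(LinearMap.range (cornerMap F e f)) := by
  have hcorner (a v : IncidenceAlgebra F X) (g h : G) (hv : v ∈ ℬ g) :
      (DirectSum.decompose ℬ (v * a) (h + g) : IncidenceAlgebra F X)
        = v * DirectSum.decompose ℬ a h := by
    rw [add_comm, DirectSum.coe_decompose_mul_add_of_left_mem ℬ hv]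
  constructor
  · refine GradedAlgebra.finrank_dvd_finrank_of_graded_division_action ℬ (LinearMap.mul F _)
      _ _ (fun b hb => decompose_mem_range_cornerMap ℬ he_mem he_mem he_idem he_idem hb)
      (fun v hv => decompose_mem_range_cornerMap ℬ he_mem hf_mem he_idem hf_idem hv)
      (fun b v g h hv => DirectSum.coe_decompose_mul_add_of_right_mem ℬ hv) ?_ ?_ ?_ ?_
    all_goals simp only [mem_range_cornerMap he_idem he_idem, mem_range_cornerMap he_idem hf_idem,
      LinearMap.mul_apply']
    · rintro b ⟨hb, -⟩ v ⟨-, hv⟩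
      exact ⟨by rw [← mul_assoc, hb], by rw [mul_assoc, hv]⟩
    · rintro b ⟨hb, -⟩ b' ⟨-, hb'⟩
      exact ⟨b * b', ⟨by rw [← mul_assoc, hb], by rw [mul_assoc, hb']⟩,
        fun v _ => (mul_assoc b b' v).symm⟩
    · exact ⟨e, ⟨he_idem, he_idem⟩, fun v hv => hv.1⟩
    · rintro g b ⟨heb, hbe⟩ hbg hb0
      obtain ⟨c, hec, hce, hcb, -⟩ := IncidenceAlgebra.exists_corner_inverse_of_ne_zero ℬ he_mem
        he_idem he_ne he_min hbg heb hbe hb0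
      exact ⟨c, ⟨hec, hce⟩, fun v hv => by rw [← mul_assoc, hcb, hv.1]⟩
  · refine GradedAlgebra.finrank_dvd_finrank_of_graded_division_action ℬ (LinearMap.mul F _).flip
      _ _ (fun b hb => decompose_mem_range_cornerMap ℬ hf_mem hf_mem hf_idem hf_idem hb)
      (fun v hv => decompose_mem_range_cornerMap ℬ he_mem hf_mem he_idem hf_idem hv)
      (fun b v g h hv => hcorner b v g h hv) ?_ ?_ ?_ ?_
    all_goals simp only [mem_range_cornerMap hf_idem hf_idem, mem_range_cornerMap he_idem hf_idem,
      LinearMap.flip_apply, LinearMap.mul_apply']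
    · rintro b ⟨-, hb⟩ v ⟨hv, -⟩
      exact ⟨by rw [← mul_assoc, hv], by rw [mul_assoc, hb]⟩
    · rintro b ⟨-, hb⟩ b' ⟨hb', -⟩
      exact ⟨b' * b, ⟨by rw [← mul_assoc, hb'], by rw [mul_assoc, hb]⟩,
        fun v _ => mul_assoc v b' b⟩
    · exact ⟨f, ⟨hf_idem, hf_idem⟩, fun v hv => hv.2⟩
    · rintro g b ⟨hfb, hbf⟩ hbg hb0
      obtain ⟨c, hfc, hcf, -, hbc⟩ := IncidenceAlgebra.exists_corner_inverse_of_ne_zero ℬ hf_mem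
        hf_idem hf_ne hf_min hbg hfb hbf hb0
      exact ⟨c, ⟨hfc, hcf⟩, fun v hv => by rw [mul_assoc, hbc, hv.2]⟩
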